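/- arXiv:2207.04180 — 2 statements merged into one kernel-verified Lean document; each statement's English description precedes it below -/
import Mathlib

section
/- Let n ≥ 1 be an integer and 0 < δ < n + 1. Then for every y ∈ ℝⁿ∖{0}, 𝓑_δ(y) = [(2π)^{(n−1)/2} 2^{δ/2} Γ(δ/2) Γ((n−δ+1)/2)]^{−1} · e^{−|y|} ∫₀^∞ e^{−|y|s} (s + s²/2)^{(n−δ−1)/2} ds. -/
open MeasureTheory
open scoped Real

/-- The integrand defining the Bessel kernel `𝓑_b`. -/
noncomputable def besselIntegrand (n : ℕ) (b : ℝ) (y : EuclideanSpace ℝ (Fin n)) (t : ℝ) : ℝ :=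
  Real.exp (-t / (4 * π)) * Real.exp (-π * ‖y‖ ^ 2 / t) * t ^ ((b - n) / 2 - 1)

/-- The Bessel kernel
`𝓑_b(y) = (4π)^{−b/2} Γ(b/2)^{−1} ∫₀^∞ e^{−δ/(4π)} e^{−π|y|²/δ} δ^{(b−n)/2} dδ/δ`. -/
noncomputable def besselKernel (n : ℕ) (b : ℝ) (y : EuclideanSpace ℝ (Fin n)) : ℝ :=
  ((4 * π) ^ (b / 2) * Real.Gamma (b / 2))⁻¹ * ∫ t in Set.Ioi (0 : ℝ), besselIntegrand n b y t

open Set in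
/-- The weighted form of the Cauchy–Schlömilch substitution `w = p v - q / v` for the Gaussian. -/
lemma lintegral_weight_mul_exp_neg_sq_sub_div {p q : ℝ} (hp : 0 < p) (hq : 0 < q) :
    ∫⁻ v in Ioi (0 : ℝ), ENNReal.ofReal (p + q / v ^ 2) *
      ENNReal.ofReal (Real.exp (-(p * v - q / v) ^ 2)) = ENNReal.ofReal (√π) := by
  have hderiv : ∀ v ∈ Ioi (0 : ℝ),
      HasDerivWithinAt (fun v => p * v - q / v) (p + q / v ^ 2) (Ioi 0) v := by
    intro v hv
    have hv' : v ≠ 0 := ne_of_gt hv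
    have h : HasDerivAt (fun v => p * v - q / v) (p * 1 - q * -(v ^ 2)⁻¹) v :=
      ((hasDerivAt_id v).const_mul p).sub ((hasDerivAt_inv hv').const_mul q)
    exact (h.congr_deriv (by ring)).hasDerivWithinAt
  have hinj : InjOn (fun v => p * v - q / v) (Ioi 0) := by
    refine StrictMonoOn.injOn fun x hx y hy hxy => ?_
    have hx' : 0 < x := hx
    have h1 : q / y < q / x := by gcongr
    have h2 : p * x < p * y := by gcongr
    linarith
  have himage : (fun v => p * v - q / v) '' Ioi 0 = univ := by
    refine eq_univ_of_forall fun w => ?_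
    have hsq : √(w ^ 2 + 4 * p * q) ^ 2 = w ^ 2 + 4 * p * q := Real.sq_sqrt (by positivity)
    have hlt : |w| < √(w ^ 2 + 4 * p * q) := by
      rw [← Real.sqrt_sq_eq_abs]
      exact Real.sqrt_lt_sqrt (sq_nonneg w) (by linarith [mul_pos hp hq])
    have hpos : 0 < w + √(w ^ 2 + 4 * p * q) := by linarith [neg_abs_le w]
    refine ⟨(w + √(w ^ 2 + 4 * p * q)) / (2 * p), by rw [mem_Ioi]; positivity, ?_⟩
    generalize √(w ^ 2 + 4 * p * q) = S at hsq hpos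
    have hpos' := hpos.ne'
    field_simp
    linear_combination hsq
  have h := lintegral_image_eq_lintegral_abs_deriv_mul measurableSet_Ioi hderiv hinj
    (fun w => ENNReal.ofReal (Real.exp (-w ^ 2)))
  rw [himage, Measure.restrict_univ] at h
  have hgauss : ∫⁻ w : ℝ, ENNReal.ofReal (Real.exp (-w ^ 2)) = ENNReal.ofReal (√π) := by
    rw [← ofReal_integral_eq_lintegral_ofReal
      (by simpa using integrable_exp_neg_mul_sq one_pos)
      (Filter.Eventually.of_forall fun _ => (Real.exp_pos _).le)]
    simpa using congrArg ENNReal.ofReal (integral_gaussian 1)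
  rw [← hgauss, h]
  refine setLIntegral_congr_fun measurableSet_Ioi fun v _ => ?_
  rw [abs_of_pos (by positivity)]

open Set in
/-- The Gaussian in `p v - q / v` is invariant under `v ↦ (q / p) / v`. -/
lemma lintegral_div_sq_mul_exp_neg_sq_sub_div {p q : ℝ} (hp : 0 < p) (hq : 0 < q) :
    ∫⁻ v in Ioi (0 : ℝ), ENNReal.ofReal (q / v ^ 2) *
        ENNReal.ofReal (Real.exp (-(p * v - q / v) ^ 2)) =
      ENNReal.ofReal p *
        ∫⁻ v in Ioi (0 : ℝ), ENNReal.ofReal (Real.exp (-(p * v - q / v) ^ 2)) := by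
  have hderiv : ∀ v ∈ Ioi (0 : ℝ),
      HasDerivWithinAt (fun v => q / p / v) (-(q / p / v ^ 2)) (Ioi 0) v := by
    intro v hv
    have hv' : v ≠ 0 := ne_of_gt hv
    have h : HasDerivAt (fun v => q / p / v) (q / p * -(v ^ 2)⁻¹) v :=
      (hasDerivAt_inv hv').const_mul (q / p)
    exact (h.congr_deriv (by ring)).hasDerivWithinAt
  have hinj : InjOn (fun v => q / p / v) (Ioi 0) := by
    intro x hx y hy hxy
    have hx' : x ≠ 0 := ne_of_gt hx
    have hy' : y ≠ 0 := ne_of_gt hy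
    simp only at hxy
    field_simp at hxy
    exact hxy.symm
  have himage : (fun v => q / p / v) '' Ioi 0 = Ioi 0 := by
    ext w
    constructor
    · rintro ⟨v, hv, rfl⟩
      have hv' : 0 < v := hv
      rw [mem_Ioi]
      positivity
    · intro hw
      have hw' : 0 < w := hw
      refine ⟨q / p / w, by rw [mem_Ioi]; positivity, ?_⟩
      field_simp
  have h := lintegral_image_eq_lintegral_abs_deriv_mul measurableSet_Ioi hderiv hinj
    (fun v => ENNReal.ofReal (Real.exp (-(p * v - q / v) ^ 2)))
  rw [himage] at h
  rw [h, ← lintegral_const_mul _ (by fun_prop)]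
  refine setLIntegral_congr_fun measurableSet_Ioi fun v hv => ?_
  have hv' : 0 < v := hv
  rw [abs_neg, abs_of_pos (by positivity), ← mul_assoc, ← ENNReal.ofReal_mul hp.le]
  congr 2
  · field_simp
  · congr 2
    field_simp
    ring

open Set in
/-- Cauchy–Schlömilch formula for the Gaussian. -/
lemma lintegral_exp_neg_sq_sub_div {p q : ℝ} (hp : 0 < p) (hq : 0 < q) :
    ∫⁻ v in Ioi (0 : ℝ), ENNReal.ofReal (Real.exp (-(p * v - q / v) ^ 2)) =
      ENNReal.ofReal (√π / (2 * p)) := by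
  have h : ENNReal.ofReal (2 * p) *
      ∫⁻ v in Ioi (0 : ℝ), ENNReal.ofReal (Real.exp (-(p * v - q / v) ^ 2)) =
        ENNReal.ofReal (√π) := by
    rw [two_mul, ENNReal.ofReal_add hp.le hp.le, add_mul]
    nth_rewrite 2 [← lintegral_div_sq_mul_exp_neg_sq_sub_div hp hq]
    rw [← lintegral_weight_mul_exp_neg_sq_sub_div hp hq, ← lintegral_const_mul _ (by fun_prop),
      ← lintegral_add_left (by fun_prop)]
    refine lintegral_congr fun v => ?_
    rw [ENNReal.ofReal_add hp.le (by positivity), add_mul]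
  rw [ENNReal.ofReal_div_of_pos (by positivity),
    ENNReal.eq_div_iff (by simpa using hp) ENNReal.ofReal_ne_top, h]

open Set in
/-- The Laplace-type integral `∫₀^∞ e^{-p² t - q² / t} t^{-1/2} dt = √π e^{-2pq} / p`. -/
lemma lintegral_exp_neg_mul_exp_neg_div_mul_rpow {p q : ℝ} (hp : 0 < p) (hq : 0 < q) :
    ∫⁻ t in Ioi (0 : ℝ), ENNReal.ofReal
        (Real.exp (-(p ^ 2 * t)) * Real.exp (-(q ^ 2 / t)) * t ^ (-(1 / 2) : ℝ)) =
      ENNReal.ofReal (√π * Real.exp (-(2 * p * q)) / p) := by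
  have hderiv : ∀ v ∈ Ioi (0 : ℝ),
      HasDerivWithinAt (fun v : ℝ => v ^ 2) (2 * v) (Ioi 0) v := by
    intro v _
    simpa using (hasDerivAt_pow 2 v).hasDerivWithinAt
  have hinj : InjOn (fun v : ℝ => v ^ 2) (Ioi 0) := by
    intro x hx y hy hxy
    exact (pow_left_inj₀ (le_of_lt hx) (le_of_lt hy) two_ne_zero).1 hxy
  have himage : (fun v : ℝ => v ^ 2) '' Ioi 0 = Ioi 0 := by
    ext w
    constructor
    · rintro ⟨v, hv, rfl⟩
      exact pow_pos (show 0 < v from hv) 2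
    · intro hw
      exact ⟨√w, Real.sqrt_pos.2 hw, Real.sq_sqrt (le_of_lt hw)⟩
  have h := lintegral_image_eq_lintegral_abs_deriv_mul measurableSet_Ioi hderiv hinj
    (fun t => ENNReal.ofReal
      (Real.exp (-(p ^ 2 * t)) * Real.exp (-(q ^ 2 / t)) * t ^ (-(1 / 2) : ℝ)))
  rw [himage] at h
  have hvalue : √π * Real.exp (-(2 * p * q)) / p =
      2 * Real.exp (-(2 * p * q)) * (√π / (2 * p)) := by
    field_simp
  rw [h, hvalue, ENNReal.ofReal_mul (by positivity), ← lintegral_exp_neg_sq_sub_div hp hq,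
    ← lintegral_const_mul _ (by fun_prop)]
  refine setLIntegral_congr_fun measurableSet_Ioi fun v hv => ?_
  have hv' : 0 < v := hv
  have hrpow : (v ^ 2) ^ (-(1 / 2) : ℝ) = v⁻¹ := by
    rw [Real.rpow_neg (by positivity), ← Real.sqrt_eq_rpow, Real.sqrt_sq hv'.le]
  rw [abs_of_pos (by positivity), ← ENNReal.ofReal_mul (by positivity),
    ← ENNReal.ofReal_mul (by positivity), hrpow, mul_assoc 2 (Real.exp _), ← Real.exp_add,
    ← Real.exp_add]
  congr 1
  have hexp : -(p ^ 2 * v ^ 2) + -(q ^ 2 / v ^ 2) = -(2 * p * q) + -(p * v - q / v) ^ 2 := by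
    field_simp
    ring
  rw [hexp]
  field_simp

open Set in
/-- The Gamma integral, as a formula for the Lebesgue integral. -/
lemma lintegral_rpow_mul_exp_neg_mul {a c : ℝ} (ha : 0 < a) (hc : 0 < c) :
    ∫⁻ x in Ioi (0 : ℝ), ENNReal.ofReal (x ^ (a - 1) * Real.exp (-(c * x))) =
      ENNReal.ofReal ((1 / c) ^ a * Real.Gamma a) := by
  rw [← Real.integral_rpow_mul_exp_neg_mul_Ioi ha hc, ofReal_integral_eq_lintegral_ofReal]
  · simpa [IntegrableOn] using
      integrableOn_rpow_mul_exp_neg_mul_rpow (s := a - 1) (by linarith) one_pos hc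
  · filter_upwards [ae_restrict_mem measurableSet_Ioi] with x hx
    have hx' : 0 < x := hx
    positivity

open Set in
/-- The substitution `x = 2 s + s²`, that is `1 + x = (1 + s)²`, on the positive half-line. -/
lemma lintegral_Ioi_comp_two_mul_add_sq (g : ℝ → ENNReal) :
    ∫⁻ x in Ioi (0 : ℝ), g x =
      ∫⁻ s in Ioi (0 : ℝ), ENNReal.ofReal (2 + 2 * s) * g (2 * s + s ^ 2) := by
  have hderiv : ∀ s ∈ Ioi (0 : ℝ),
      HasDerivWithinAt (fun s : ℝ => 2 * s + s ^ 2) (2 + 2 * s) (Ioi 0) s := by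
    intro s _
    have h : HasDerivAt (fun s : ℝ => 2 * s + s ^ 2) (2 * 1 + (2 : ℕ) * s ^ (2 - 1)) s :=
      ((hasDerivAt_id s).const_mul 2).add (hasDerivAt_pow 2 s)
    exact (h.congr_deriv (by simp)).hasDerivWithinAt
  have hinj : InjOn (fun s : ℝ => 2 * s + s ^ 2) (Ioi 0) := by
    refine StrictMonoOn.injOn fun x hx y hy hxy => ?_
    have hx' : 0 < x := hx
    gcongr
  have himage : (fun s : ℝ => 2 * s + s ^ 2) '' Ioi 0 = Ioi 0 := by
    ext w
    constructor
    · rintro ⟨s, hs, rfl⟩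
      have hs' : 0 < s := hs
      rw [mem_Ioi]
      positivity
    · intro hw
      have hw' : 0 < w := hw
      have hsq : √(1 + w) ^ 2 = 1 + w := Real.sq_sqrt (by positivity)
      refine ⟨√(1 + w) - 1, ?_, by simp only; linear_combination hsq⟩
      rw [mem_Ioi, sub_pos, Real.lt_sqrt zero_le_one]
      linarith
  have h := lintegral_image_eq_lintegral_abs_deriv_mul measurableSet_Ioi hderiv hinj g
  rw [himage] at h
  rw [h]
  refine setLIntegral_congr_fun measurableSet_Ioi fun s hs => ?_
  have hs' : 0 < s := hs
  rw [abs_of_pos (by positivity)]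

open Set in
/-- The Macdonald-function identity behind the representation formula of the Bessel kernel, for
Lebesgue integrals. -/
lemma lintegral_exp_neg_div_mul_exp_neg_div_mul_rpow {μ r : ℝ} (hμ : 0 < μ) (hr : 0 < r) :
    ENNReal.ofReal ((4 * π) ^ μ * Real.Gamma μ) * ∫⁻ t in Ioi (0 : ℝ), ENNReal.ofReal
        (Real.exp (-t / (4 * π)) * Real.exp (-π * r ^ 2 / t) * t ^ (-(1 / 2) - μ)) =
      ENNReal.ofReal (4 * π * 2 ^ (μ - 1) * Real.exp (-r)) * ∫⁻ s in Ioi (0 : ℝ),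
        ENNReal.ofReal (Real.exp (-r * s) * (s + s ^ 2 / 2) ^ (μ - 1)) := by
  have hπ := Real.pi_pos
  have hΓ := Real.Gamma_pos_of_pos hμ
  have hstep : ENNReal.ofReal ((4 * π) ^ μ * Real.Gamma μ) * ∫⁻ t in Ioi (0 : ℝ), ENNReal.ofReal
        (Real.exp (-t / (4 * π)) * Real.exp (-π * r ^ 2 / t) * t ^ (-(1 / 2) - μ)) =
      ∫⁻ t in Ioi (0 : ℝ), ∫⁻ x in Ioi (0 : ℝ),
        ENNReal.ofReal
          (Real.exp (-t / (4 * π)) * Real.exp (-π * r ^ 2 / t) * t ^ (-(1 / 2) : ℝ)) *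
        ENNReal.ofReal (x ^ (μ - 1) * Real.exp (-(t / (4 * π) * x))) := by
    rw [← lintegral_const_mul _ (by fun_prop)]
    refine setLIntegral_congr_fun measurableSet_Ioi fun t ht => ?_
    have ht' : 0 < t := ht
    rw [lintegral_const_mul _ (by fun_prop), lintegral_rpow_mul_exp_neg_mul hμ (by positivity),
      ← ENNReal.ofReal_mul (by positivity), ← ENNReal.ofReal_mul (by positivity)]
    congr 1
    rw [one_div_div, Real.div_rpow (by positivity) ht'.le, Real.rpow_sub ht']
    ring
  rw [hstep, lintegral_lintegral_swap (by fun_prop), lintegral_Ioi_comp_two_mul_add_sq,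
    ← lintegral_const_mul _ (by fun_prop)]
  refine setLIntegral_congr_fun measurableSet_Ioi fun s hs => ?_
  have hs' : 0 < s := hs
  have hp : 0 < (1 + s) / (2 * √π) := by positivity
  have hq : 0 < √π * r := by positivity
  have hsqrt : √π ^ 2 = π := Real.sq_sqrt hπ.le
  have hinner : ∫⁻ t in Ioi (0 : ℝ), ENNReal.ofReal
          (Real.exp (-t / (4 * π)) * Real.exp (-π * r ^ 2 / t) * t ^ (-(1 / 2) : ℝ)) *
        ENNReal.ofReal ((2 * s + s ^ 2) ^ (μ - 1) *
          Real.exp (-(t / (4 * π) * (2 * s + s ^ 2)))) =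
      ENNReal.ofReal ((2 * s + s ^ 2) ^ (μ - 1)) * ENNReal.ofReal
        (√π * Real.exp (-(2 * ((1 + s) / (2 * √π)) * (√π * r))) / ((1 + s) / (2 * √π))) := by
    rw [← lintegral_exp_neg_mul_exp_neg_div_mul_rpow hp hq, ← lintegral_const_mul _ (by fun_prop)]
    refine setLIntegral_congr_fun measurableSet_Ioi fun t ht => ?_
    have ht' : 0 < t := ht
    rw [← ENNReal.ofReal_mul (by positivity), ← ENNReal.ofReal_mul (by positivity)]
    congr 1
    have hexp : Real.exp (-(((1 + s) / (2 * √π)) ^ 2 * t)) =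
        Real.exp (-t / (4 * π)) * Real.exp (-(t / (4 * π) * (2 * s + s ^ 2))) := by
      rw [← Real.exp_add, div_pow, mul_pow, hsqrt]
      congr 1
      field_simp
      ring
    have hexp' : -((√π * r) ^ 2 / t) = -π * r ^ 2 / t := by
      rw [mul_pow, hsqrt]
      ring
    rw [hexp, hexp']
    ring
  rw [hinner, ← ENNReal.ofReal_mul (by positivity), ← ENNReal.ofReal_mul (by positivity),
    ← ENNReal.ofReal_mul (by positivity)]
  congr 1
  have hrpow : (2 * s + s ^ 2) ^ (μ - 1) = 2 ^ (μ - 1) * (s + s ^ 2 / 2) ^ (μ - 1) := by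
    rw [← Real.mul_rpow zero_le_two (by positivity)]
    ring_nf
  have hexp : Real.exp (-(2 * ((1 + s) / (2 * √π)) * (√π * r))) =
      Real.exp (-r) * Real.exp (-r * s) := by
    rw [← Real.exp_add]
    congr 1
    field_simp
    ring
  have hconst : √π * (Real.exp (-r) * Real.exp (-r * s)) / ((1 + s) / (2 * √π)) =
      2 * π * (Real.exp (-r) * Real.exp (-r * s)) / (1 + s) := by
    field_simp
    linear_combination hsqrt
  rw [hrpow, hexp, hconst]
  field_simp
  ring

open Set in
/-- The Macdonald-function identity behind the representation formula of the Bessel kernel. -/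
lemma integral_exp_neg_div_mul_exp_neg_div_mul_rpow {μ r : ℝ} (hμ : 0 < μ) (hr : 0 < r) :
    (4 * π) ^ μ * Real.Gamma μ * ∫ t in Ioi (0 : ℝ),
        Real.exp (-t / (4 * π)) * Real.exp (-π * r ^ 2 / t) * t ^ (-(1 / 2) - μ) =
      4 * π * 2 ^ (μ - 1) * Real.exp (-r) * ∫ s in Ioi (0 : ℝ),
        Real.exp (-r * s) * (s + s ^ 2 / 2) ^ (μ - 1) := by
  have hπ := Real.pi_pos
  have hΓ := Real.Gamma_pos_of_pos hμ
  have h := congrArg ENNReal.toReal (lintegral_exp_neg_div_mul_exp_neg_div_mul_rpow hμ hr)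
  rw [ENNReal.toReal_mul, ENNReal.toReal_mul, ENNReal.toReal_ofReal (by positivity),
    ENNReal.toReal_ofReal (by positivity), ← integral_eq_lintegral_of_nonneg_ae,
    ← integral_eq_lintegral_of_nonneg_ae] at h
  · exact h
  · filter_upwards [ae_restrict_mem measurableSet_Ioi] with s hs
    have hs' : 0 < s := hs
    positivity
  · exact Measurable.aestronglyMeasurable (by fun_prop)
  · filter_upwards [ae_restrict_mem measurableSet_Ioi] with t ht
    have ht' : 0 < t := ht
    positivity
  · exact Measurable.aestronglyMeasurable (by fun_prop)

/-- Calderón–Zygmund representation formula for the Bessel kernel: for `0 < δ < n + 1` and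
`y ≠ 0`,
`𝓑_δ(y) = [(2π)^{(n−1)/2} 2^{δ/2} Γ(δ/2) Γ((n−δ+1)/2)]^{−1} e^{−|y|}
  ∫₀^∞ e^{−|y|s}(s + s²/2)^{(n−δ−1)/2} ds`. -/
theorem stmt6 (n : ℕ) (hn : 1 ≤ n) (δ : ℝ) (hδ0 : 0 < δ) (hδn : δ < n + 1)
    (y : EuclideanSpace ℝ (Fin n)) (hy : y ≠ 0) :
    besselKernel n δ y =
      ((2 * π) ^ (((n : ℝ) - 1) / 2) * 2 ^ (δ / 2) * Real.Gamma (δ / 2) *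
          Real.Gamma (((n : ℝ) - δ + 1) / 2))⁻¹ *
        (Real.exp (-‖y‖) *
          ∫ s in Set.Ioi (0 : ℝ),
            Real.exp (-‖y‖ * s) * (s + s ^ 2 / 2) ^ (((n : ℝ) - δ - 1) / 2)) := by
  have hπ := Real.pi_pos
  have hμ : 0 < ((n : ℝ) - δ + 1) / 2 := by linarith
  have hΓ := Real.Gamma_pos_of_pos hμ
  have hΓδ := Real.Gamma_pos_of_pos (half_pos hδ0)
  have h := integral_exp_neg_div_mul_exp_neg_div_mul_rpow hμ (norm_pos_iff.2 hy)
  rw [show -(1 / 2) - ((n : ℝ) - δ + 1) / 2 = (δ - n) / 2 - 1 by ring,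
    show ((n : ℝ) - δ + 1) / 2 - 1 = ((n : ℝ) - δ - 1) / 2 by ring] at h
  have hpow : (2 * π) ^ (((n : ℝ) - 1) / 2) * 2 ^ (δ / 2) *
      (4 * π * 2 ^ (((n : ℝ) - δ - 1) / 2)) =
      (4 * π) ^ (δ / 2) * (4 * π) ^ (((n : ℝ) - δ + 1) / 2) := by
    rw [← Real.rpow_add (by positivity),
      show δ / 2 + ((n : ℝ) - δ + 1) / 2 = (n - 1) / 2 + 1 by ring,
      Real.rpow_add_one (by positivity), show 4 * π = 2 * (2 * π) by ring,
      Real.mul_rpow (y := 2 * π) zero_le_two (by positivity),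
      show ((n : ℝ) - 1) / 2 = δ / 2 + (n - δ - 1) / 2 by ring, Real.rpow_add two_pos (δ / 2)]
    ring
  unfold besselKernel besselIntegrand
  rw [inv_mul_eq_div, inv_mul_eq_div, div_eq_div_iff (by positivity) (by positivity)]
  have hne : (4 * π) ^ (((n : ℝ) - δ + 1) / 2) ≠ 0 := by positivity
  apply mul_left_cancel₀ hne
  linear_combination ((2 * π) ^ (((n : ℝ) - 1) / 2) * 2 ^ (δ / 2) * Real.Gamma (δ / 2)) * h +
    Real.Gamma (δ / 2) * Real.exp (-‖y‖) * (∫ s in Set.Ioi (0 : ℝ),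
      Real.exp (-‖y‖ * s) * (s + s ^ 2 / 2) ^ (((n : ℝ) - δ - 1) / 2)) * hpow
end

section
/- Let n ≥ 1 be an integer, 0 < δ < n + 1, and let β be a multi-index with |β| ≥ 1. Then 𝓑_δ is smooth on ℝⁿ∖{0}, and there exists a constant C = C(n, δ, β) > 0 such that for every y ∈ ℝⁿ∖{0}, |∂_y^β 𝓑_δ(y)| ≤ C e^{−|y|} (1 + |y|^{δ−n−|β|}). -/
open MeasureTheory
open scoped Real

/-- The partial derivative of `f : ℝⁿ → ℝ` in the `i`-th coordinate direction. -/
noncomputable def partialDeriv (n : ℕ) (i : Fin n) (f : EuclideanSpace ℝ (Fin n) → ℝ) :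
    EuclideanSpace ℝ (Fin n) → ℝ :=
  fun x => fderiv ℝ f x (EuclideanSpace.single i 1)

/-- The multi-index derivative `∂^β f = ∂₁^{β₁} ⋯ ∂ₙ^{βₙ} f`. -/
noncomputable def multiDeriv (n : ℕ) (β : Fin n → ℕ) (f : EuclideanSpace ℝ (Fin n) → ℝ) :
    EuclideanSpace ℝ (Fin n) → ℝ :=
  (List.finRange n).foldr (fun i g => (partialDeriv n i)^[β i] g) f

theorem exists_rpow_mul_exp_neg_mul_le {a c : ℝ} (ha : 0 < a) (hc : 0 ≤ c) :
    ∃ C : ℝ, 0 < C ∧ ∀ w : ℝ, 0 < w → w ^ c * Real.exp (-a * w) ≤ C := by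
  obtain ⟨N, hN⟩ := exists_nat_ge c
  refine ⟨1 + N.factorial / a ^ N, by positivity, fun w hw => ?_⟩
  have h1 : w ^ c ≤ 1 + w ^ N := by
    rcases le_total w 1 with h | h
    · have := Real.rpow_le_one hw.le h hc
      have : 0 < w ^ N := by positivity
      linarith
    · have := Real.rpow_le_rpow_of_exponent_le h hN
      rw [Real.rpow_natCast] at this
      linarith
  have h2 := Real.pow_div_factorial_le_exp (a * w) (by positivity) N
  have h3 : w ^ N ≤ N.factorial / a ^ N * Real.exp (a * w) := by
    rw [div_le_iff₀ (by positivity), mul_pow] at h2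
    rw [div_mul_eq_mul_div, le_div_iff₀ (by positivity)]
    linarith
  have h4 : 1 ≤ Real.exp (a * w) := Real.one_le_exp (by positivity)
  rw [neg_mul, Real.exp_neg, ← div_eq_mul_inv, div_le_iff₀ (Real.exp_pos _)]
  nlinarith

theorem exists_exp_neg_div_mul_rpow_le {a q M : ℝ} (ha : 0 < a) (hM : q ≤ M) :
    ∃ C : ℝ, 0 < C ∧ ∀ t : ℝ, 0 < t → Real.exp (-a / t) * t ^ q ≤ C * t ^ M := by
  obtain ⟨C, hC, h⟩ := exists_rpow_mul_exp_neg_mul_le ha (sub_nonneg.2 hM)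
  refine ⟨C, hC, fun t ht => ?_⟩
  have h1 := h t⁻¹ (inv_pos.2 ht)
  rw [Real.inv_rpow ht.le, ← Real.rpow_neg ht.le, neg_sub] at h1
  calc Real.exp (-a / t) * t ^ q = t ^ (q - M) * Real.exp (-a * t⁻¹) * t ^ M := by
        rw [mul_right_comm, ← Real.rpow_add ht, sub_add_cancel, div_eq_mul_inv, mul_comm]
    _ ≤ C * t ^ M := by gcongr

theorem integrableOn_exp_mul_exp_neg_div_mul_rpow {a b : ℝ} (ha : 0 < a) (hb : 0 < b) (q : ℝ) :
    IntegrableOn (fun t : ℝ => Real.exp (-b * t) * Real.exp (-a / t) * t ^ q) (Set.Ioi 0) := by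
  obtain ⟨C, hC, h⟩ := exists_exp_neg_div_mul_rpow_le ha (le_max_left q 0)
  have hi := (integrableOn_rpow_mul_exp_neg_mul_rpow (p := 1) (s := max q 0) (b := b)
    (by linarith [le_max_right q 0]) one_pos hb).const_mul C
  refine hi.mono' (by fun_prop) ?_
  filter_upwards [self_mem_ae_restrict measurableSet_Ioi] with t (ht : 0 < t)
  rw [Real.norm_of_nonneg (by positivity), Real.rpow_one]
  have := mul_le_mul_of_nonneg_left (h t ht) (Real.exp_pos (-b * t)).le
  nlinarith

theorem integrableOn_exp_neg_div_mul_rpow {a q : ℝ} (ha : 0 < a) (hq : q < -1) :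
    IntegrableOn (fun t : ℝ => Real.exp (-a / t) * t ^ q) (Set.Ioi 0) := by
  rw [← Set.Ioc_union_Ioi_eq_Ioi zero_le_one]
  refine IntegrableOn.union ?_ ?_
  · obtain ⟨C, -, h⟩ := exists_exp_neg_div_mul_rpow_le (M := 0) ha (by linarith : q ≤ 0)
    refine Measure.integrableOn_of_bounded (M := C) (by simp) (by fun_prop) ?_
    filter_upwards [self_mem_ae_restrict measurableSet_Ioc] with t ht
    have h0 : 0 < t := ht.1
    rw [Real.norm_of_nonneg (by positivity)]
    simpa using h t h0
  · refine (integrableOn_Ioi_rpow_of_lt hq one_pos).mono' (by fun_prop) ?_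
    filter_upwards [self_mem_ae_restrict measurableSet_Ioi] with t (ht : 1 < t)
    have h0 : 0 < t := by linarith
    rw [Real.norm_of_nonneg (by positivity)]
    refine mul_le_of_le_one_left (by positivity) (Real.exp_le_one_iff.2 ?_)
    exact div_nonpos_of_nonpos_of_nonneg (by linarith) h0.le

/-- The radial profile of the Bessel kernel, as a function of `x = |y|²`. -/
noncomputable def besselProfile (p x : ℝ) : ℝ :=
  ∫ t in Set.Ioi (0 : ℝ), Real.exp (-t / (4 * π)) * Real.exp (-π * x / t) * t ^ (p - 1)

theorem integrableOn_besselProfile {x : ℝ} (hx : 0 < x) (q : ℝ) :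
    IntegrableOn (fun t : ℝ => Real.exp (-t / (4 * π)) * Real.exp (-π * x / t) * t ^ q)
      (Set.Ioi 0) := by
  have := integrableOn_exp_mul_exp_neg_div_mul_rpow (a := π * x) (b := 1 / (4 * π))
    (by positivity) (by positivity) q
  refine this.congr_fun (fun t _ => ?_) measurableSet_Ioi
  dsimp only
  congr 3 <;> ring

theorem besselProfile_nonneg (p x : ℝ) : 0 ≤ besselProfile p x :=
  setIntegral_nonneg measurableSet_Ioi fun t (ht : 0 < t) => by positivity

theorem hasDerivAt_besselProfile (p : ℝ) {x : ℝ} (hx : 0 < x) :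
    HasDerivAt (besselProfile p) (-π * besselProfile (p - 1) x) x := by
  have key := hasDerivAt_integral_of_dominated_loc_of_deriv_le
    (μ := volume.restrict (Set.Ioi (0 : ℝ))) (s := Set.Ioi (x / 2))
    (F := fun x t => Real.exp (-t / (4 * π)) * Real.exp (-π * x / t) * t ^ (p - 1))
    (F' := fun x t => -π * (Real.exp (-t / (4 * π)) * Real.exp (-π * x / t) * t ^ (p - 1 - 1)))
    (bound := fun t => π * (Real.exp (-t / (4 * π)) * Real.exp (-π * (x / 2) / t) *
      t ^ (p - 1 - 1))) (x₀ := x)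
    (Ioi_mem_nhds (by linarith)) (.of_forall fun x => by fun_prop)
    (integrableOn_besselProfile hx _) (by fun_prop) ?_
    ((integrableOn_besselProfile (half_pos hx) _).const_mul π) ?_
  · have h := key.2
    rw [integral_const_mul] at h
    exact h
  · filter_upwards [self_mem_ae_restrict measurableSet_Ioi] with t (ht : 0 < t) z (hz : x / 2 < z)
    rw [norm_mul, norm_neg, Real.norm_of_nonneg Real.pi_pos.le,
      Real.norm_of_nonneg (by positivity)]
    have : -π * z / t ≤ -π * (x / 2) / t := by
      gcongr ?_ / t
      nlinarith [Real.pi_pos]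
    gcongr
  · filter_upwards [self_mem_ae_restrict measurableSet_Ioi] with t (ht : 0 < t) z hz
    have h1 : HasDerivAt (fun z : ℝ => -π * z / t) (-π / t) z := by
      simpa using ((hasDerivAt_id z).const_mul (-π)).div_const t
    refine ((h1.exp.const_mul (Real.exp (-t / (4 * π)))).mul_const (t ^ (p - 1))).congr_deriv ?_
    rw [Real.rpow_sub_one ht.ne' (p - 1)]
    ring

theorem contDiffOn_besselProfile (p : ℝ) :
    ContDiffOn ℝ (⊤ : ℕ∞) (besselProfile p) (Set.Ioi 0) := by
  refine contDiffOn_infty.2 fun k => ?_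
  induction k generalizing p with
  | zero =>
    exact contDiffOn_zero.2 fun x hx =>
      (hasDerivAt_besselProfile p hx).continuousAt.continuousWithinAt
  | succ k ih =>
    push_cast
    refine (contDiffOn_succ_iff_deriv_of_isOpen isOpen_Ioi).2 ⟨fun x hx =>
      (hasDerivAt_besselProfile p hx).differentiableAt.differentiableWithinAt, by simp, ?_⟩
    exact (contDiffOn_const.mul (ih (p - 1))).congr fun x hx => (hasDerivAt_besselProfile p hx).deriv

theorem exists_besselProfile_sq_le_rpow {p : ℝ} (hp : p < 0) :
    ∃ C : ℝ, 0 ≤ C ∧ ∀ r : ℝ, 0 < r → besselProfile p (r ^ 2) ≤ C * r ^ (2 * p) := by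
  refine ⟨∫ t in Set.Ioi (0 : ℝ), Real.exp (-π / t) * t ^ (p - 1),
    setIntegral_nonneg measurableSet_Ioi fun t (ht : 0 < t) => by positivity, fun r hr => ?_⟩
  have hr2 : 0 < r ^ 2 := by positivity
  have hi := integrableOn_exp_neg_div_mul_rpow Real.pi_pos (by linarith : p - 1 < -1)
  have hs := integral_comp_mul_left_Ioi (fun t : ℝ => Real.exp (-π * r ^ 2 / t) * t ^ (p - 1)) 0 hr2
  rw [mul_zero, smul_eq_mul, eq_inv_mul_iff_mul_eq₀ hr2.ne'] at hs
  have hsc : ∀ t ∈ Set.Ioi (0 : ℝ), Real.exp (-π * r ^ 2 / (r ^ 2 * t)) * (r ^ 2 * t) ^ (p - 1) =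
      (r ^ 2) ^ (p - 1) * (Real.exp (-π / t) * t ^ (p - 1)) := by
    intro t (ht : 0 < t)
    rw [Real.mul_rpow hr2.le ht.le, show -π * r ^ 2 / (r ^ 2 * t) = -π / t by field_simp]
    ring
  rw [setIntegral_congr_fun measurableSet_Ioi hsc, integral_const_mul, ← mul_assoc] at hs
  have hpow : r ^ 2 * (r ^ 2) ^ (p - 1) = r ^ (2 * p) := by
    rw [Real.rpow_sub_one hr2.ne', mul_div_cancel₀ _ hr2.ne', ← Real.rpow_natCast_mul hr.le]
    norm_num
  rw [hpow] at hs
  rw [mul_comm, hs]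
  have hi' : IntegrableOn (fun t : ℝ => Real.exp (-π * r ^ 2 / t) * t ^ (p - 1)) (Set.Ioi 0) := by
    have := integrableOn_exp_neg_div_mul_rpow (a := π * r ^ 2) (by positivity)
      (by linarith : p - 1 < -1)
    simpa only [neg_mul] using this
  refine setIntegral_mono_on (integrableOn_besselProfile hr2 _) hi' measurableSet_Ioi ?_
  intro t (ht : 0 < t)
  rw [mul_assoc]
  refine mul_le_of_le_one_left (by positivity) (Real.exp_le_one_iff.2 ?_)
  exact div_nonpos_of_nonpos_of_nonneg (by linarith) (by positivity)

theorem exp_neg_mul_rpow_le_gaussian_add {r u q : ℝ} (hr : 1 ≤ r) (hu : 0 < u) :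
    Real.exp (-(r * (u - 1) ^ 2 / (2 * u))) * u ^ q ≤
      (2 ^ q + (1 / 2) ^ q) * Real.exp (-(r / 4) * (u - 1) ^ 2) +
        Real.exp (-(1 / 8) * r) * (Real.exp (1 / 2) *
          (Real.exp (-(1 / 4) * u) * Real.exp (-(1 / 4) / u) * u ^ q)) := by
  have hA : (0 : ℝ) < 2 ^ q := by positivity
  have hB : (0 : ℝ) < (1 / 2) ^ q := by positivity
  by_cases hu' : 1 / 2 ≤ u ∧ u ≤ 2
  · have h1 : u ^ q ≤ 2 ^ q + (1 / 2) ^ q := by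
      rcases le_total 0 q with hq | hq
      · have := Real.rpow_le_rpow hu.le hu'.2 hq
        linarith
      · have := Real.rpow_le_rpow_of_nonpos (by norm_num) hu'.1 hq
        linarith
    have h2 : -(r * (u - 1) ^ 2 / (2 * u)) ≤ -(r / 4) * (u - 1) ^ 2 := by
      rw [neg_mul, neg_le_neg_iff, le_div_iff₀ (by positivity)]
      have : 0 ≤ r * (u - 1) ^ 2 := by positivity
      nlinarith
    have h3 : Real.exp (-(r * (u - 1) ^ 2 / (2 * u))) * u ^ q ≤
        (2 ^ q + (1 / 2) ^ q) * Real.exp (-(r / 4) * (u - 1) ^ 2) := by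
      rw [mul_comm]
      gcongr
    have : 0 ≤ Real.exp (-(1 / 8) * r) * (Real.exp (1 / 2) *
          (Real.exp (-(1 / 4) * u) * Real.exp (-(1 / 4) / u) * u ^ q)) := by positivity
    linarith
  · have hX : 1 / 2 ≤ (u - 1) ^ 2 / u := by
      rw [le_div_iff₀ hu]
      rw [not_and_or, not_le, not_le] at hu'
      rcases hu' with h | h <;> nlinarith
    have h2 : -(r * (u - 1) ^ 2 / (2 * u)) ≤
        -(1 / 8) * r + (1 / 2 + (-(1 / 4) * u + -(1 / 4) / u)) := by
      have e1 : r * (u - 1) ^ 2 / (2 * u) = r / 2 * ((u - 1) ^ 2 / u) := by field_simp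
      have e2 : 1 / 2 + (-(1 / 4) * u + -(1 / 4) / u) = -(1 / 4) * ((u - 1) ^ 2 / u) := by
        field_simp
        ring
      rw [e1, e2]
      nlinarith
    have h3 := mul_le_mul_of_nonneg_right (Real.exp_le_exp.2 h2) (Real.rpow_nonneg hu.le q)
    rw [Real.exp_add, Real.exp_add, Real.exp_add] at h3
    have : 0 ≤ (2 ^ q + (1 / 2) ^ q) * Real.exp (-(r / 4) * (u - 1) ^ 2) := by positivity
    linarith

theorem integrable_exp_neg_mul_sub_one_sq {b : ℝ} (hb : 0 < b) :
    Integrable fun u : ℝ => Real.exp (-b * (u - 1) ^ 2) :=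
  (integrable_exp_neg_mul_sq hb).comp_sub_right 1

theorem exists_integral_laplace_le (q : ℝ) :
    ∃ C : ℝ, 0 ≤ C ∧ ∀ r : ℝ, 1 ≤ r →
      ∫ u in Set.Ioi (0 : ℝ), Real.exp (-(r * (u - 1) ^ 2 / (2 * u))) * u ^ q ≤
        C * r ^ (-(1 / 2) : ℝ) := by
  obtain ⟨K, hK, hKr⟩ := exists_rpow_mul_exp_neg_mul_le (a := 1 / 8) (c := 1 / 2) (by norm_num)
    (by norm_num)
  have hB := (integrableOn_exp_mul_exp_neg_div_mul_rpow (a := 1 / 4) (b := 1 / 4) (by norm_num)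
    (by norm_num) q).const_mul (Real.exp (1 / 2))
  set B : ℝ := ∫ u in Set.Ioi (0 : ℝ), Real.exp (1 / 2) *
    (Real.exp (-(1 / 4) * u) * Real.exp (-(1 / 4) / u) * u ^ q) with hBdef
  have hB0 : 0 ≤ B :=
    setIntegral_nonneg measurableSet_Ioi fun t (ht : 0 < t) => by positivity
  refine ⟨(2 ^ q + (1 / 2) ^ q) * √(4 * π) + K * B, by positivity, fun r hr => ?_⟩
  have hr0 : 0 < r := by linarith
  have hG := (integrable_exp_neg_mul_sub_one_sq (b := r / 4) (by positivity))
  have hGv : ∫ u in Set.Ioi (0 : ℝ), Real.exp (-(r / 4) * (u - 1) ^ 2) ≤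
      √(4 * π) * r ^ (-(1 / 2) : ℝ) := by
    refine (setIntegral_le_integral hG (.of_forall fun u => (Real.exp_pos _).le)).trans_eq ?_
    rw [integral_sub_right_eq_self (fun u : ℝ => Real.exp (-(r / 4) * u ^ 2)) 1, integral_gaussian,
      show π / (r / 4) = 4 * π / r by field_simp, Real.sqrt_div (by positivity),
      Real.rpow_neg hr0.le, ← Real.sqrt_eq_rpow, div_eq_mul_inv]
  have hmono : ∫ u in Set.Ioi (0 : ℝ), Real.exp (-(r * (u - 1) ^ 2 / (2 * u))) * u ^ q ≤
      ∫ u in Set.Ioi (0 : ℝ), ((2 ^ q + (1 / 2) ^ q) * Real.exp (-(r / 4) * (u - 1) ^ 2) +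
        Real.exp (-(1 / 8) * r) * (Real.exp (1 / 2) *
          (Real.exp (-(1 / 4) * u) * Real.exp (-(1 / 4) / u) * u ^ q))) := by
    refine integral_mono_of_nonneg ?_
      ((hG.integrableOn.const_mul _).add (hB.const_mul _)) ?_
    · filter_upwards [self_mem_ae_restrict measurableSet_Ioi] with u (hu : 0 < u)
      exact mul_nonneg (Real.exp_pos _).le (Real.rpow_nonneg hu.le q)
    · filter_upwards [self_mem_ae_restrict measurableSet_Ioi] with u (hu : 0 < u)
      exact exp_neg_mul_rpow_le_gaussian_add hr hu
  refine hmono.trans ?_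
  rw [integral_add (hG.integrableOn.const_mul _) (hB.const_mul _), integral_const_mul,
    integral_const_mul, ← hBdef]
  have hE : Real.exp (-(1 / 8) * r) ≤ K * r ^ (-(1 / 2) : ℝ) := by
    have := hKr r hr0
    rw [Real.rpow_neg hr0.le, ← div_eq_mul_inv, le_div_iff₀ (by positivity), mul_comm]
    exact this
  calc _ ≤ (2 ^ q + (1 / 2) ^ q) * (√(4 * π) * r ^ (-(1 / 2) : ℝ)) +
        K * r ^ (-(1 / 2) : ℝ) * B := by gcongr
    _ = _ := by ring

theorem exists_besselProfile_sq_le_exp (p : ℝ) :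
    ∃ C : ℝ, 0 ≤ C ∧ ∀ r : ℝ, 1 ≤ r →
      besselProfile p (r ^ 2) ≤ C * (Real.exp (-r) * r ^ (p - 1 / 2)) := by
  obtain ⟨C, hC, h⟩ := exists_integral_laplace_le (p - 1)
  refine ⟨(2 * π) ^ p * C, by positivity, fun r hr => ?_⟩
  have hr0 : 0 < r := by linarith
  have hb : 0 < 2 * π * r := by positivity
  have hs := integral_comp_mul_left_Ioi
    (fun t : ℝ => Real.exp (-t / (4 * π)) * Real.exp (-π * r ^ 2 / t) * t ^ (p - 1)) 0 hb
  rw [mul_zero, smul_eq_mul, eq_inv_mul_iff_mul_eq₀ hb.ne'] at hs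
  have hsc : ∀ u ∈ Set.Ioi (0 : ℝ), Real.exp (-(2 * π * r * u) / (4 * π)) *
      Real.exp (-π * r ^ 2 / (2 * π * r * u)) * (2 * π * r * u) ^ (p - 1) =
      Real.exp (-r) * (2 * π * r) ^ (p - 1) *
        (Real.exp (-(r * (u - 1) ^ 2 / (2 * u))) * u ^ (p - 1)) := by
    intro u (hu : 0 < u)
    have he : -(2 * π * r * u) / (4 * π) + -π * r ^ 2 / (2 * π * r * u) =
        -r + -(r * (u - 1) ^ 2 / (2 * u)) := by
      field_simp
      ring
    rw [Real.mul_rpow hb.le hu.le, ← Real.exp_add, he, Real.exp_add]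
    ring
  rw [setIntegral_congr_fun measurableSet_Ioi hsc, integral_const_mul] at hs
  have hpow : 2 * π * r * (2 * π * r) ^ (p - 1) = (2 * π) ^ p * r ^ p := by
    rw [Real.rpow_sub_one hb.ne', mul_div_cancel₀ _ hb.ne',
      Real.mul_rpow (by positivity) hr0.le]
  have hr2 : r ^ (p - 1 / 2) = r ^ p * r ^ (-(1 / 2) : ℝ) := by
    rw [← Real.rpow_add hr0, sub_eq_add_neg]
  rw [besselProfile, ← hs, hr2]
  calc _ = Real.exp (-r) * (2 * π * r * (2 * π * r) ^ (p - 1)) *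
        ∫ u in Set.Ioi (0 : ℝ), Real.exp (-(r * (u - 1) ^ 2 / (2 * u))) * u ^ (p - 1) := by ring
    _ ≤ Real.exp (-r) * ((2 * π) ^ p * r ^ p) * (C * r ^ (-(1 / 2) : ℝ)) := by
        rw [hpow]
        gcongr
        exact h r hr
    _ = _ := by ring

theorem hasFDerivAt_besselProfile_norm_sq {n : ℕ} (p : ℝ) {y : EuclideanSpace ℝ (Fin n)}
    (hy : y ≠ 0) :
    HasFDerivAt (fun y : EuclideanSpace ℝ (Fin n) => besselProfile p (‖y‖ ^ 2))
      ((-π * besselProfile (p - 1) (‖y‖ ^ 2)) • (2 • innerSL ℝ y)) y :=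
  (hasDerivAt_besselProfile p (by positivity)).comp_hasFDerivAt y
    (hasStrictFDerivAt_norm_sq y).hasFDerivAt

theorem partialDeriv_besselProfile_norm_sq {n : ℕ} (p : ℝ) (i : Fin n)
    {y : EuclideanSpace ℝ (Fin n)} (hy : y ≠ 0) :
    partialDeriv n i (fun y => besselProfile p (‖y‖ ^ 2)) y =
      -(2 * π) * (y i * besselProfile (p - 1) (‖y‖ ^ 2)) := by
  rw [partialDeriv, (hasFDerivAt_besselProfile_norm_sq p hy).fderiv]
  simp [EuclideanSpace.inner_single_right]
  ring

theorem partialDeriv_congr_of_ne_zero {n : ℕ} {f g : EuclideanSpace ℝ (Fin n) → ℝ}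
    (h : ∀ y, y ≠ 0 → f y = g y) (i : Fin n) {y : EuclideanSpace ℝ (Fin n)} (hy : y ≠ 0) :
    partialDeriv n i f y = partialDeriv n i g y := by
  have : f =ᶠ[nhds y] g := by
    filter_upwards [isOpen_ne.mem_nhds hy] with z hz using h z hz
  rw [partialDeriv, partialDeriv, this.fderiv_eq]

/-- Functions which, away from the origin, are linear combinations of products of coordinates with
the functions `besselProfile p (‖y‖²)`, `p < 0`. The first index records the order `2s - k` of
homogeneity at the origin, the second one the order `s - e - 1/2` of the power correction to the
exponential decay at infinity. -/
inductive BesselClass (n : ℕ) (s : ℝ) : ℝ → ℝ → (EuclideanSpace ℝ (Fin n) → ℝ) → Prop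
  | profile (p : ℝ) (hp : p < 0) :
      BesselClass n s (2 * (s - p)) (s - p) fun y => besselProfile p (‖y‖ ^ 2)
  | coord_mul {k e f} (j : Fin n) (hf : BesselClass n s k e f) :
      BesselClass n s (k - 1) (e - 1) fun y => y j * f y
  | add {k e f g} (hf : BesselClass n s k e f) (hg : BesselClass n s k e g) :
      BesselClass n s k e fun y => f y + g y
  | const_mul {k e f} (c : ℝ) (hf : BesselClass n s k e f) :
      BesselClass n s k e fun y => c * f y
  | weaken {k e e' f} (he : e' ≤ e) (hf : BesselClass n s k e f) : BesselClass n s k e' f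
  | congr {k e f g} (hfg : ∀ y, y ≠ 0 → g y = f y) (hf : BesselClass n s k e f) :
      BesselClass n s k e g

namespace BesselClass

variable {n : ℕ} {s k e : ℝ} {f : EuclideanSpace ℝ (Fin n) → ℝ}

theorem cast {k' e' : ℝ} (hf : BesselClass n s k e f) (hk : k = k') (he : e = e') :
    BesselClass n s k' e' f := hk ▸ he ▸ hf

theorem partialDeriv_profile {p : ℝ} (hp : p - 1 < 0) (i : Fin n) :
    BesselClass n s (2 * (s - p) + 1) (s - p)
      (partialDeriv n i fun y => besselProfile p (‖y‖ ^ 2)) :=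
  ((((profile (p - 1) hp).coord_mul i).const_mul (-(2 * π))).congr fun _ hy =>
    partialDeriv_besselProfile_norm_sq p i hy).cast (by ring) (by ring)

theorem differentiableAt (hf : BesselClass n s k e f) {y : EuclideanSpace ℝ (Fin n)}
    (hy : y ≠ 0) : DifferentiableAt ℝ f y := by
  induction hf with
  | profile p hp => exact (hasFDerivAt_besselProfile_norm_sq p hy).differentiableAt
  | coord_mul j hf ih => exact (EuclideanSpace.proj (𝕜 := ℝ) j).differentiableAt.mul ih
  | add hf hg ihf ihg => exact ihf.add ihg
  | const_mul c hf ih => exact ih.const_mul c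
  | weaken he hf ih => exact ih
  | congr hfg hf ih =>
    refine ih.congr_of_eventuallyEq ?_
    filter_upwards [isOpen_ne.mem_nhds hy] with z hz using hfg z hz

theorem partialDeriv (hf : BesselClass n s k e f) (i : Fin n) :
    BesselClass n s (k + 1) e (partialDeriv n i f) := by
  induction hf with
  | profile p hp => exact partialDeriv_profile (by linarith) i
  | @coord_mul k e f j hf ih =>
    refine (((hf.weaken (by linarith : e - 1 ≤ e)).const_mul
      (EuclideanSpace.single i (1 : ℝ) j)).cast (by ring : k = k - 1 + 1) rfl).add
      ((ih.coord_mul j).cast (by ring : k + 1 - 1 = k - 1 + 1) rfl) |>.congr fun y hy => ?_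
    have h := ((EuclideanSpace.proj (𝕜 := ℝ) j).hasFDerivAt (x := y)).mul
      (hf.differentiableAt hy).hasFDerivAt
    rw [_root_.partialDeriv, _root_.partialDeriv]
    erw [h.fderiv]
    simp
    ring
  | add hf hg ihf ihg =>
    refine (ihf.add ihg).congr fun y hy => ?_
    rw [_root_.partialDeriv, fderiv_fun_add (hf.differentiableAt hy) (hg.differentiableAt hy)]
    rfl
  | const_mul c hf ih =>
    refine (ih.const_mul c).congr fun y hy => ?_
    rw [_root_.partialDeriv, fderiv_const_mul (hf.differentiableAt hy)]
    rfl
  | weaken he hf ih => exact ih.weaken he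
  | congr hfg hf ih => exact ih.congr fun y hy => partialDeriv_congr_of_ne_zero hfg i hy

theorem exists_bound (hf : BesselClass n s k e f) :
    ∃ C : ℝ, 0 ≤ C ∧ (∀ y, y ≠ 0 → |f y| ≤ C * ‖y‖ ^ (2 * s - k)) ∧
      ∀ y, 1 ≤ ‖y‖ → |f y| ≤ C * (Real.exp (-‖y‖) * ‖y‖ ^ (s - e - 1 / 2)) := by
  induction hf with
  | profile p hp =>
    obtain ⟨C₁, hC₁, h₁⟩ := exists_besselProfile_sq_le_rpow hp
    obtain ⟨C₂, hC₂, h₂⟩ := exists_besselProfile_sq_le_exp p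
    refine ⟨max C₁ C₂, hC₁.trans (le_max_left _ _), fun y hy => ?_, fun y hy => ?_⟩
    · rw [abs_of_nonneg (besselProfile_nonneg _ _), show 2 * s - 2 * (s - p) = 2 * p by ring]
      refine (h₁ _ (norm_pos_iff.2 hy)).trans ?_
      gcongr
      exact le_max_left _ _
    · rw [abs_of_nonneg (besselProfile_nonneg _ _), show s - (s - p) - 1 / 2 = p - 1 / 2 by ring]
      refine (h₂ _ hy).trans ?_
      gcongr
      exact le_max_right _ _
  | @coord_mul k e f j hf ih =>
    obtain ⟨C, hC, h₁, h₂⟩ := ih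
    refine ⟨C, hC, fun y hy => ?_, fun y hy => ?_⟩
    · rw [abs_mul, show 2 * s - (k - 1) = 1 + (2 * s - k) by ring,
        Real.rpow_add (norm_pos_iff.2 hy), Real.rpow_one, mul_left_comm]
      exact mul_le_mul (PiLp.norm_apply_le y j) (h₁ y hy) (abs_nonneg _) (norm_nonneg _)
    · rw [abs_mul, show s - (e - 1) - 1 / 2 = 1 + (s - e - 1 / 2) by ring,
        Real.rpow_add (by linarith), Real.rpow_one, mul_left_comm (Real.exp _), mul_left_comm]
      exact mul_le_mul (PiLp.norm_apply_le y j) (h₂ y hy) (abs_nonneg _) (norm_nonneg _)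
  | add hf hg ihf ihg =>
    obtain ⟨C, hC, h₁, h₂⟩ := ihf
    obtain ⟨D, hD, g₁, g₂⟩ := ihg
    refine ⟨C + D, by positivity, fun y hy => ?_, fun y hy => ?_⟩
    · rw [add_mul]
      exact (abs_add_le _ _).trans (add_le_add (h₁ y hy) (g₁ y hy))
    · rw [add_mul]
      exact (abs_add_le _ _).trans (add_le_add (h₂ y hy) (g₂ y hy))
  | const_mul c hf ih =>
    obtain ⟨C, hC, h₁, h₂⟩ := ih
    refine ⟨|c| * C, by positivity, fun y hy => ?_, fun y hy => ?_⟩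
    · rw [abs_mul, mul_assoc]
      exact mul_le_mul_of_nonneg_left (h₁ y hy) (abs_nonneg c)
    · rw [abs_mul, mul_assoc]
      exact mul_le_mul_of_nonneg_left (h₂ y hy) (abs_nonneg c)
  | weaken he hf ih =>
    obtain ⟨C, hC, h₁, h₂⟩ := ih
    refine ⟨C, hC, h₁, fun y hy => (h₂ y hy).trans ?_⟩
    gcongr
  | congr hfg hf ih =>
    obtain ⟨C, hC, h₁, h₂⟩ := ih
    refine ⟨C, hC, fun y hy => hfg y hy ▸ h₁ y hy, fun y hy => hfg y ?_ ▸ h₂ y hy⟩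
    rintro rfl
    norm_num at hy

end BesselClass

theorem besselKernel_eq (n : ℕ) (b : ℝ) : besselKernel n b = fun y =>
    ((4 * π) ^ (b / 2) * Real.Gamma (b / 2))⁻¹ * besselProfile ((b - n) / 2) (‖y‖ ^ 2) :=
  rfl

theorem contDiffOn_besselKernel (n : ℕ) (b : ℝ) :
    ContDiffOn ℝ (⊤ : ℕ∞) (besselKernel n b) {y | y ≠ 0} :=
  contDiffOn_const.mul <| (contDiffOn_besselProfile _).comp (contDiff_norm_sq ℝ).contDiffOn
    fun y (hy : y ≠ 0) => show 0 < ‖y‖ ^ 2 by positivity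

theorem besselClass_partialDeriv_besselKernel {n : ℕ} {b : ℝ} (hb : b < n + 1) (i : Fin n) :
    BesselClass n ((b - n) / 2) 1 0 (partialDeriv n i (besselKernel n b)) := by
  refine ((BesselClass.partialDeriv_profile (s := (b - n) / 2) (p := (b - n) / 2) (by linarith) i).const_mul
    ((4 * π) ^ (b / 2) * Real.Gamma (b / 2))⁻¹ |>.congr fun y hy => ?_).cast (by ring) (by ring)
  rw [besselKernel_eq, partialDeriv,
    fderiv_const_mul (hasFDerivAt_besselProfile_norm_sq _ hy).differentiableAt]
  rfl

theorem besselClass_iterate_partialDeriv {n : ℕ} {b : ℝ} (hb : b < n + 1) (i : Fin n) {k : ℕ}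
    {f : EuclideanSpace ℝ (Fin n) → ℝ}
    (hf : (k = 0 ∧ f = besselKernel n b) ∨ BesselClass n ((b - n) / 2) k 0 f) (m : ℕ) :
    (m + k = 0 ∧ (partialDeriv n i)^[m] f = besselKernel n b) ∨
      BesselClass n ((b - n) / 2) (m + k : ℕ) 0 ((partialDeriv n i)^[m] f) := by
  induction m with
  | zero => simpa using hf
  | succ m ih =>
    right
    rw [Function.iterate_succ_apply']
    rcases ih with ⟨h0, h⟩ | h
    · rw [h]
      refine (besselClass_partialDeriv_besselKernel hb i).cast ?_ rfl
      rw [add_right_comm, h0]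
      simp
    · refine (h.partialDeriv i).cast ?_ rfl
      push_cast
      ring

theorem besselClass_multiDeriv {n : ℕ} {b : ℝ} (hb : b < n + 1) {β : Fin n → ℕ}
    (hβ : 1 ≤ ∑ i, β i) :
    BesselClass n ((b - n) / 2) (∑ i, β i : ℕ) 0 (multiDeriv n β (besselKernel n b)) := by
  have key : ∀ L : List (Fin n),
      ((L.map β).sum = 0 ∧
        L.foldr (fun i g => (partialDeriv n i)^[β i] g) (besselKernel n b) = besselKernel n b) ∨
      BesselClass n ((b - n) / 2) ((L.map β).sum : ℕ) 0
        (L.foldr (fun i g => (partialDeriv n i)^[β i] g) (besselKernel n b)) := by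
    intro L
    induction L with
    | nil => simp
    | cons i L ih => simpa only [List.map_cons, List.sum_cons, List.foldr_cons] using
        besselClass_iterate_partialDeriv hb i ih (β i)
  have h := key (List.finRange n)
  rw [← Fin.sum_univ_def] at h
  exact h.resolve_left fun h0 => by omega

/-- For `0 < δ < n + 1` and a multi-index `β` with `|β| ≥ 1`: `𝓑_δ` is smooth away from the
origin and `|∂^β 𝓑_δ(y)| ≤ C e^{−|y|}(1 + |y|^{δ−n−|β|})` for `y ≠ 0`. -/
theorem stmt9 (n : ℕ) (hn : 1 ≤ n) (δ : ℝ) (hδ0 : 0 < δ) (hδn : δ < n + 1)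
    (β : Fin n → ℕ) (hβ : 1 ≤ ∑ i, β i) :
    ContDiffOn ℝ (⊤ : ℕ∞) (besselKernel n δ) {y | y ≠ 0} ∧
    ∃ C : ℝ, 0 < C ∧ ∀ y : EuclideanSpace ℝ (Fin n), y ≠ 0 →
      |multiDeriv n β (besselKernel n δ) y| ≤
        C * Real.exp (-‖y‖) * (1 + ‖y‖ ^ (δ - n - (∑ i, β i : ℕ))) := by
  refine ⟨contDiffOn_besselKernel n δ, ?_⟩
  obtain ⟨C, hC, h₁, h₂⟩ := (besselClass_multiDeriv hδn hβ).exists_bound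
  refine ⟨C * Real.exp 1 + 1, by positivity, fun y hy => ?_⟩
  have hy0 : 0 < ‖y‖ := norm_pos_iff.2 hy
  have hD : C ≤ C * Real.exp 1 := le_mul_of_one_le_right hC (Real.one_le_exp zero_le_one)
  have hr : 0 < ‖y‖ ^ (δ - n - (∑ i, β i : ℕ)) := by positivity
  rcases le_total ‖y‖ 1 with hle | hge
  · calc _ ≤ C * ‖y‖ ^ (2 * ((δ - n) / 2) - (∑ i, β i : ℕ)) := h₁ y hy
      _ = C * 1 * ‖y‖ ^ (δ - n - (∑ i, β i : ℕ)) := by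
        rw [mul_one, mul_div_cancel₀ _ (two_ne_zero)]
      _ ≤ C * (Real.exp 1 * Real.exp (-‖y‖)) * (1 + ‖y‖ ^ (δ - n - (∑ i, β i : ℕ))) := by
        rw [← Real.exp_add]
        gcongr
        · exact Real.one_le_exp (by linarith)
        · linarith
      _ ≤ _ := by
        rw [← mul_assoc]
        gcongr
        linarith
  · calc _ ≤ C * (Real.exp (-‖y‖) * ‖y‖ ^ ((δ - n) / 2 - 0 - 1 / 2)) := h₂ y hge
      _ ≤ C * (Real.exp (-‖y‖) * 1) := by
        gcongr
        exact Real.rpow_le_one_of_one_le_of_nonpos hge (by linarith)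
      _ ≤ (C * Real.exp 1 + 1) * (Real.exp (-‖y‖) * (1 + ‖y‖ ^ (δ - n - (∑ i, β i : ℕ)))) := by
        gcongr
        · linarith
        · linarith
      _ = _ := by ring
end
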